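/- arXiv:2306.03877 — 2 statements merged into one kernel-verified Lean document; each statement's English description precedes it below -/
import Mathlib

section
/- In the Mover–Eater game, if n^a(p(0)) ≤ |δc_i(0)|, then the outcome of game G_i when both players use the equilibrium strategies (π^{M*}_i, π^{E*}) equals c_i(0) − (1/2)·n^a(p(0))·(1 + sgn(δc_i(0))); i.e., the consumption at the true goal at termination is b_i(0) + n^r_i(p(0)) + n^a(p(0)) if δc_i(0) < 0, and b_i(0) + n^r_i(p(0)) if δc_i(0) > 0. -/
noncomputable section

open Classical

/-- Manhattan distance on the grid ℤ². -/
def mdist (p q : ℤ × ℤ) : ℤ := |p.1 - q.1| + |p.2 - q.2|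

/-- The four admissible unit moves of the Mover. -/
def IsUnitMove (e : ℤ × ℤ) : Prop :=
  e = (1, 0) ∨ e = (-1, 0) ∨ e = (0, 1) ∨ e = (0, -1)

/-- The Eater action that eats one banana from goal `j`. -/
def eatOne (j : Fin 2) : Fin 2 → ℝ := fun k => if k = j then 1 else 0

/-- The Eater action that eats half a banana from each goal. -/
def eatHalf : Fin 2 → ℝ := fun _ => 1 / 2

/-- The three admissible Eater actions. -/
def IsEaterAction (a : Fin 2 → ℝ) : Prop :=
  a = eatOne 0 ∨ a = eatOne 1 ∨ a = eatHalf

/-- A Mover strategy: maps (position, consumption vector) to a move. -/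
abbrev MoverStrategy : Type := ℤ × ℤ → (Fin 2 → ℝ) → ℤ × ℤ

/-- An Eater strategy: maps (new Mover position, last Mover move, current consumption)
to an Eater action; it is the same in both games. -/
abbrev EaterStrategy : Type := ℤ × ℤ → ℤ × ℤ → (Fin 2 → ℝ) → Fin 2 → ℝ

def ValidMover (piM : MoverStrategy) : Prop := ∀ p b, IsUnitMove (piM p b)

def ValidEater (piE : EaterStrategy) : Prop := ∀ p a b, IsEaterAction (piE p a b)

/-- State trajectory (position, consumption vector) of the game under a strategy pair:
`p(t+1) = p(t) + a^M(t)`, `b(t+1) = b(t) + a^E(t)`. -/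
def traj (piM : MoverStrategy) (piE : EaterStrategy) (p0 : ℤ × ℤ) (b0 : Fin 2 → ℝ) :
    ℕ → (ℤ × ℤ) × (Fin 2 → ℝ)
  | 0 => (p0, b0)
  | t + 1 =>
    let s := traj piM piE p0 b0 t
    let m := piM s.1 s.2
    (s.1 + m, fun j => s.2 j + piE (s.1 + m) m s.2 j)

/-- Termination time of game `G_i`: the first time the Mover's position equals `goal`. -/
def hitTime (piM : MoverStrategy) (piE : EaterStrategy) (p0 : ℤ × ℤ) (b0 : Fin 2 → ℝ)
    (goal : ℤ × ℤ) : ℕ :=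
  sInf {t | (traj piM piE p0 b0 t).1 = goal}

/-- The outcome `J_i` of game `G_i`: consumption at the true goal `g i` at termination. -/
def outcome (g : Fin 2 → ℤ × ℤ) (i : Fin 2) (piM : MoverStrategy) (piE : EaterStrategy)
    (p0 : ℤ × ℤ) (b0 : Fin 2 → ℝ) : ℝ :=
  (traj piM piE p0 b0 (hitTime piM piE p0 b0 (g i))).2 i

/-- Admissibility: the Mover reaches the goal in finite time. -/
def Reaches (piM : MoverStrategy) (piE : EaterStrategy) (p0 : ℤ × ℤ) (b0 : Fin 2 → ℝ)
    (goal : ℤ × ℤ) : Prop :=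
  ∃ t, (traj piM piE p0 b0 t).1 = goal

/-- A step from `p` to `p'` is ambiguous: `δd₁ = δd₂`. -/
def IsAmbStep (g : Fin 2 → ℤ × ℤ) (p p' : ℤ × ℤ) : Prop :=
  mdist p' (g 0) - mdist p (g 0) = mdist p' (g 1) - mdist p (g 1)

/-- A step from `p` to `p'` is explicit: `δd₁ = −δd₂`. -/
def IsExpStep (g : Fin 2 → ℤ × ℤ) (p p' : ℤ × ℤ) : Prop :=
  mdist p' (g 0) - mdist p (g 0) = -(mdist p' (g 1) - mdist p (g 1))

/-- A path of `T` unit moves from `p` to `goal`. -/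
def IsPath (p goal : ℤ × ℤ) (T : ℕ) (q : ℕ → ℤ × ℤ) : Prop :=
  q 0 = p ∧ q T = goal ∧ ∀ t < T, IsUnitMove (q (t + 1) - q t)

/-- Number of ambiguous moves along a path. -/
def ambCount (g : Fin 2 → ℤ × ℤ) (T : ℕ) (q : ℕ → ℤ × ℤ) : ℕ :=
  ((Finset.range T).filter fun t => IsAmbStep g (q t) (q (t + 1))).card

/-- Number of explicit moves along a path. -/
def expCount (g : Fin 2 → ℤ × ℤ) (T : ℕ) (q : ℕ → ℤ × ℤ) : ℕ :=
  ((Finset.range T).filter fun t => IsExpStep g (q t) (q (t + 1))).card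

/-- `n^a(p)`: minimum number of ambiguous moves over paths from `p` to a goal. -/
def naN (g : Fin 2 → ℤ × ℤ) (p : ℤ × ℤ) : ℕ :=
  sInf {n : ℕ | ∃ i : Fin 2, ∃ T q, IsPath p (g i) T q ∧ ambCount g T q = n}

/-- `n^r_i(p)`: minimum number of explicit moves needed to reach `g i` from `p`. -/
def nrN (g : Fin 2 → ℤ × ℤ) (i : Fin 2) (p : ℤ × ℤ) : ℕ :=
  sInf {n : ℕ | ∃ T q, IsPath p (g i) T q ∧ expCount g T q = n}

/-- The equilibrium Eater strategy `π^{E*}`: after an ambiguous Mover move the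
conservative action (based on the sign of `δ̃c₁`), after an explicit move the
exploiting action (eat from the approached goal). -/
def piEstar (g : Fin 2 → ℤ × ℤ) : EaterStrategy := fun p' a b =>
  let p := p' - a
  let d1 := mdist p' (g 0) - mdist p (g 0)
  let d2 := mdist p' (g 1) - mdist p (g 1)
  if d1 = d2 then
    if (b 0 + (mdist p' (g 0) : ℝ)) - (b 1 + (mdist p' (g 1) : ℝ)) < 0 then eatOne 0
    else if 0 < (b 0 + (mdist p' (g 0) : ℝ)) - (b 1 + (mdist p' (g 1) : ℝ)) then eatOne 1
    else eatHalf
  else if d1 < d2 then eatOne 0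
  else eatOne 1

/-- `π^{M*}_i`: the Mover strategy that (against any Eater strategy) follows a shortest
path from `p0` to `g i`, performing all `n^a(p0)` ambiguous moves first and then the
explicit moves. -/
def IsMoverStar (g : Fin 2 → ℤ × ℤ) (i : Fin 2) (p0 : ℤ × ℤ) (b0 : Fin 2 → ℝ)
    (piM : MoverStrategy) : Prop :=
  ValidMover piM ∧
  ∀ piE : EaterStrategy, ValidEater piE →
    (traj piM piE p0 b0 (mdist p0 (g i)).toNat).1 = g i ∧
    ∀ t < (mdist p0 (g i)).toNat,
      (IsAmbStep g (traj piM piE p0 b0 t).1 (traj piM piE p0 b0 (t + 1)).1 ↔ t < naN g p0)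

/-- `c_i(p, b) = b_i + d(p, g_i)`. -/
def cval (g : Fin 2 → ℤ × ℤ) (i : Fin 2) (p : ℤ × ℤ) (b : Fin 2 → ℝ) : ℝ :=
  b i + (mdist p (g i) : ℝ)

/-- `δc_i = c_i − c_{3−i}`. -/
def dcval (g : Fin 2 → ℤ × ℤ) (i : Fin 2) (p : ℤ × ℤ) (b : Fin 2 → ℝ) : ℝ :=
  cval g i p b - cval g (1 - i) p b

end

theorem aux_unit_step (p m q : ℤ × ℤ) (hm : IsUnitMove m) :
    mdist (p + m) q = mdist p q + 1 ∨ mdist (p + m) q = mdist p q - 1 := by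
  unfold mdist
  rcases hm with rfl | rfl | rfl | rfl <;> simp only [Prod.fst_add, Prod.snd_add] <;>
    simp only [abs_eq_max_neg] <;> omega

theorem aux_self (q : ℤ × ℤ) : mdist q q = 0 := by simp [mdist]

theorem aux_nonneg (p q : ℤ × ℤ) : 0 ≤ mdist p q := by unfold mdist; positivity

theorem aux_zero {p q : ℤ × ℤ} (h : p = q) : mdist p q = 0 := by subst h; exact aux_self p

theorem aux_valid (g : Fin 2 → ℤ × ℤ) : ValidEater (piEstar g) := by
  intro p a b
  unfold IsEaterAction piEstar
  dsimp only
  split_ifs <;> simp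

open Classical in
theorem aux_path (g : Fin 2 → ℤ × ℤ) (i j : Fin 2)
    (hij : (i = 0 ∧ j = 1) ∨ (i = 1 ∧ j = 0)) (q : ℕ → ℤ × ℤ) (T : ℕ)
    (h : ∀ t < T, IsUnitMove (q (t + 1) - q t)) :
    (mdist (q 0) (g i) - mdist (q 0) (g j)) - (mdist (q T) (g i) - mdist (q T) (g j))
      ≤ 2 * (expCount g T q : ℤ) := by
  induction T with
  | zero => simp [expCount]
  | succ T ih =>
    have ih := ih (fun t ht => h t (by omega))
    have hm := h T (by omega)
    have h1 := aux_unit_step (q T) _ (g i) hm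
    have h2 := aux_unit_step (q T) _ (g j) hm
    rw [add_sub_cancel] at h1 h2
    have hc : expCount g (T+1) q =
        expCount g T q + if IsExpStep g (q T) (q (T+1)) then 1 else 0 := by
      unfold expCount
      rw [Finset.range_add_one, Finset.filter_insert]
      split_ifs
      · rw [Finset.card_insert_of_notMem (by simp)]
      · simp
    rw [hc]
    unfold IsExpStep
    rcases hij with ⟨rfl, rfl⟩ | ⟨rfl, rfl⟩ <;> split_ifs <;> push_cast <;> omega

theorem aux_eat_exp (g : Fin 2 → ℤ × ℤ) (i j : Fin 2)
    (hij : (i = 0 ∧ j = 1) ∨ (i = 1 ∧ j = 0)) (p m : ℤ × ℤ) (b : Fin 2 → ℝ)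
    (hi : mdist (p + m) (g i) = mdist p (g i) - 1)
    (hj : mdist (p + m) (g j) = mdist p (g j) + 1) :
    piEstar g (p + m) m b = eatOne i := by
  unfold piEstar
  dsimp only
  rw [add_sub_cancel_right]
  rcases hij with ⟨rfl, rfl⟩ | ⟨rfl, rfl⟩
  · rw [if_neg (by omega), if_pos (by omega)]
  · rw [if_neg (by omega), if_neg (by omega)]

theorem aux_eat_amb (g : Fin 2 → ℤ × ℤ) (i j : Fin 2)
    (hij : (i = 0 ∧ j = 1) ∨ (i = 1 ∧ j = 0)) (p m : ℤ × ℤ) (b : Fin 2 → ℝ)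
    (hi : mdist (p + m) (g i) = mdist p (g i) - 1)
    (hj : mdist (p + m) (g j) = mdist p (g j) - 1)
    (hc : b i + (mdist p (g i) : ℝ) < b j + (mdist p (g j) : ℝ)) :
    piEstar g (p + m) m b = eatOne i := by
  unfold piEstar
  dsimp only
  rw [add_sub_cancel_right]
  rcases hij with ⟨rfl, rfl⟩ | ⟨rfl, rfl⟩ <;> rw [if_pos (by omega), hi, hj] <;> push_cast
  · rw [if_pos (by linarith)]
  · rw [if_neg (by linarith), if_pos (by linarith)]

theorem equilibrium_value_case_one
    (g : Fin 2 → ℤ × ℤ) (hg : g 0 ≠ g 1) (p0 : ℤ × ℤ) (b0 : Fin 2 → ℝ)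
    (hb0 : ∀ j, 0 ≤ b0 j) (i : Fin 2)
    (hcase : (naN g p0 : ℝ) ≤ |dcval g i p0 b0|)
    (piMstar : MoverStrategy) (hstar : IsMoverStar g i p0 b0 piMstar) :
    outcome g i piMstar (piEstar g) p0 b0 =
      cval g i p0 b0 - (1 / 2) * (naN g p0 : ℝ) * (1 + Real.sign (dcval g i p0 b0)) ∧
    (dcval g i p0 b0 < 0 →
      outcome g i piMstar (piEstar g) p0 b0 = b0 i + (nrN g i p0 : ℝ) + (naN g p0 : ℝ)) ∧
    (0 < dcval g i p0 b0 →
      outcome g i piMstar (piEstar g) p0 b0 = b0 i + (nrN g i p0 : ℝ)) := by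
  obtain ⟨hv, hs⟩ := hstar
  obtain ⟨hend, hamb⟩ := hs _ (aux_valid g)
  obtain ⟨j, hj⟩ : ∃ j, j = 1 - i := ⟨_, rfl⟩
  have hij : (i = 0 ∧ j = 1) ∨ (i = 1 ∧ j = 0) := by
    subst hj; fin_cases i <;> simp
  have hdc : dcval g i p0 b0 = (b0 i + (mdist p0 (g i) : ℝ)) - (b0 j + (mdist p0 (g j) : ℝ)) := by
    subst hj; rfl
  have hcv : cval g i p0 b0 = b0 i + (mdist p0 (g i) : ℝ) := rfl
  obtain ⟨n, hn⟩ : ∃ n, n = naN g p0 := ⟨_, rfl⟩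
  obtain ⟨L, hL⟩ : ∃ L, L = (mdist p0 (g i)).toNat := ⟨_, rfl⟩
  have hLd : mdist p0 (g i) = (L : ℤ) := by have := aux_nonneg p0 (g i); omega
  have hLr : (mdist p0 (g i) : ℝ) = (L : ℝ) := by rw [hLd]; simp
  rw [← hL] at hend hamb
  obtain ⟨P, hP⟩ : ∃ P : ℕ → ℤ × ℤ, P = fun t => (traj piMstar (piEstar g) p0 b0 t).1 := ⟨_, rfl⟩
  obtain ⟨B, hB⟩ : ∃ B : ℕ → Fin 2 → ℝ, B = fun t => (traj piMstar (piEstar g) p0 b0 t).2 := ⟨_, rfl⟩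
  obtain ⟨M, hM⟩ : ∃ M : ℕ → ℤ × ℤ, M = fun t => piMstar (P t) (B t) := ⟨_, rfl⟩
  have hPt : ∀ t, (traj piMstar (piEstar g) p0 b0 t).1 = P t := fun t => by rw [hP]
  have hMu : ∀ t, IsUnitMove (M t) := fun t => by rw [hM]; exact hv _ _
  have hP0 : P 0 = p0 := by rw [hP]; rfl
  have hB0 : B 0 = b0 := by rw [hB]; rfl
  have hPs : ∀ t, P (t+1) = P t + M t := fun t => by rw [hM, hP, hB]; rfl
  have hBs : ∀ t k, B (t+1) k = B t k + piEstar g (P t + M t) (M t) (B t) k :=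
    fun t k => by rw [hM, hP, hB]; rfl
  simp only [hPt, ← hn] at hend hamb
  have hstep : ∀ q t, mdist (P (t+1)) q = mdist (P t) q + 1 ∨ mdist (P (t+1)) q = mdist (P t) q - 1 :=
    fun q t => by rw [hPs]; exact aux_unit_step _ _ _ (hMu t)
  have hfwd : ∀ t, (L : ℤ) - t ≤ mdist (P t) (g i) := by
    intro t
    induction t with
    | zero => rw [hP0, hLd]; simp
    | succ t ih => have := hstep (g i) t; push_cast; omega
  have hbwd : ∀ k t, mdist (P t) (g i) ≤ mdist (P (t+k)) (g i) + k := by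
    intro k t
    induction k with
    | zero => simp
    | succ k ih => have := hstep (g i) (t+k); rw [← add_assoc]; push_cast; omega
  have hd : ∀ t ≤ L, mdist (P t) (g i) = (L : ℤ) - t := by
    intro t ht
    have h1 := hbwd (L - t) t
    have h2 := hfwd t
    rw [Nat.add_sub_cancel' ht, hend, aux_self] at h1
    omega
  have hhit : hitTime piMstar (piEstar g) p0 b0 (g i) = L := by
    unfold hitTime
    simp only [hPt]
    apply le_antisymm
    · exact Nat.sInf_le hend
    · have hmem := Nat.sInf_mem (s := {t | P t = g i}) ⟨L, hend⟩
      have h2 := hfwd (sInf {t | P t = g i})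
      rw [aux_zero hmem] at h2
      omega
  have hpath : IsPath p0 (g i) L P :=
    ⟨hP0, hend, fun t _ => by rw [hPs, add_sub_cancel_left]; exact hMu t⟩
  have hnL : n ≤ L := by
    rw [hn]
    have hle : naN g p0 ≤ ambCount g L P := Nat.sInf_le ⟨i, L, P, hpath, rfl⟩
    refine hle.trans ?_
    unfold ambCount
    classical
    exact (Finset.card_filter_le _ _).trans (by simp)
  have hdi : ∀ t < L, mdist (P (t+1)) (g i) = mdist (P t) (g i) - 1 := by
    intro t ht
    rw [hd t ht.le, hd (t+1) ht]; push_cast; ring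
  have hja : ∀ t < n, mdist (P (t+1)) (g j) = mdist (P t) (g j) - 1 := by
    intro t ht
    have h1 := (hamb t (by omega)).2 ht
    have h2 := hdi t (by omega)
    unfold IsAmbStep at h1
    rcases hij with ⟨rfl, rfl⟩ | ⟨rfl, rfl⟩ <;> omega
  have hje : ∀ t < L, n ≤ t → mdist (P (t+1)) (g j) = mdist (P t) (g j) + 1 := by
    intro t ht hnt
    have h1 := mt (hamb t ht).1 (by omega)
    have h2 := hdi t (by omega)
    have h3 := hstep (g j) t
    unfold IsAmbStep at h1
    rcases hij with ⟨rfl, rfl⟩ | ⟨rfl, rfl⟩ <;> omega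
  have hdj1 : ∀ t ≤ n, mdist (P t) (g j) = mdist p0 (g j) - t := by
    intro t ht
    induction t with
    | zero => rw [hP0]; simp
    | succ t ih => rw [hja t ht, ih (by omega)]; push_cast; ring
  have hdj2 : ∀ k, n + k ≤ L → mdist (P (n + k)) (g j) = mdist p0 (g j) - n + k := by
    intro k hk
    induction k with
    | zero => simpa using hdj1 n le_rfl
    | succ k ih => rw [← add_assoc, hje (n+k) (by omega) (by omega), ih (by omega)]; push_cast; ring
  have hnr : nrN g i p0 = L - n := by
    have hdL := hdj2 (L - n) (by omega)
    rw [Nat.add_sub_cancel' hnL, hend] at hdL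
    apply le_antisymm
    · apply Nat.sInf_le
      refine ⟨L, P, hpath, ?_⟩
      unfold expCount
      classical
      have : (Finset.range L).filter (fun t => IsExpStep g (P t) (P (t+1))) = Finset.Ico n L := by
        ext t
        simp only [Finset.mem_filter, Finset.mem_range, Finset.mem_Ico]
        constructor
        · rintro ⟨h1, h2⟩
          refine ⟨?_, h1⟩
          by_contra hlt
          have h3 := hja t (by omega)
          have h4 := hdi t h1
          unfold IsExpStep at h2
          rcases hij with ⟨rfl, rfl⟩ | ⟨rfl, rfl⟩ <;> omega
        · rintro ⟨h1, h2⟩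
          refine ⟨h2, ?_⟩
          have h3 := hje t h2 h1
          have h4 := hdi t h2
          unfold IsExpStep
          rcases hij with ⟨rfl, rfl⟩ | ⟨rfl, rfl⟩ <;> omega
      convert Nat.card_Ico n L
    · have hne : {n : ℕ | ∃ T q, IsPath p0 (g i) T q ∧ expCount g T q = n}.Nonempty :=
        ⟨expCount g L P, L, P, hpath, rfl⟩
      apply le_csInf hne
      rintro x ⟨T, q, ⟨hq0, hqT, hq⟩, rfl⟩
      have := aux_path g i j hij q T hq
      rw [hq0, hqT, aux_self, hLd] at this
      omega
  -- consumption in the explicit phase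
  have hBe : ∀ k, n + k ≤ L → B (n + k) i = B n i + k := by
    intro k hk
    induction k with
    | zero => simp
    | succ k ih =>
      have h1 := hdi (n+k) (by omega)
      have h2 := hje (n+k) (by omega) (by omega)
      rw [hPs] at h1 h2
      rw [← add_assoc, hBs, aux_eat_exp g i j hij _ _ _ h1 h2, ih (by omega)]
      simp [eatOne]; ring
  have hout : outcome g i piMstar (piEstar g) p0 b0 = B n i + ((L : ℝ) - n) := by
    have := hBe (L - n) (by omega)
    rw [Nat.add_sub_cancel' hnL, Nat.cast_sub hnL] at this
    unfold outcome
    rw [hhit, ← this, hB]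
  have hnej : i ≠ j := by rcases hij with ⟨rfl, rfl⟩ | ⟨rfl, rfl⟩ <;> decide
  have hneg : dcval g i p0 b0 < 0 → ∀ t ≤ n, B t i = b0 i + t ∧ B t j = b0 j := by
    intro hlt t ht
    rw [← hn, abs_of_neg hlt, hdc] at hcase
    induction t with
    | zero => simp [hB0]
    | succ t ih =>
      obtain ⟨ih1, ih2⟩ := ih (by omega)
      have h1 := hdi t (by omega)
      have h2 := hja t (by omega)
      rw [hPs] at h1 h2
      have h3 : (t : ℝ) < n := by exact_mod_cast ht
      have h4 := hd t (by omega)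
      have h5 := hdj1 t (by omega)
      have h6 := aux_eat_amb g i j hij _ _ (B t) h1 h2 (by
        rw [h4, h5, ih1, ih2]; push_cast; linarith)
      rw [hBs, hBs, h6, ih1, ih2]
      simp [eatOne, hnej.symm]; ring
  have hpos : 0 < dcval g i p0 b0 → ∀ t ≤ n, B t i = b0 i ∧ B t j = b0 j + t := by
    intro hlt t ht
    rw [← hn, abs_of_pos hlt, hdc] at hcase
    induction t with
    | zero => simp [hB0]
    | succ t ih =>
      obtain ⟨ih1, ih2⟩ := ih (by omega)
      have h1 := hdi t (by omega)
      have h2 := hja t (by omega)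
      rw [hPs] at h1 h2
      have h3 : (t : ℝ) < n := by exact_mod_cast ht
      have h4 := hd t (by omega)
      have h5 := hdj1 t (by omega)
      have h6 := aux_eat_amb g j i (by tauto) _ _ (B t) h2 h1 (by
        rw [h4, h5, ih1, ih2]; push_cast; linarith)
      rw [hBs, hBs, h6, ih1, ih2]
      simp [eatOne, hnej]; ring
  rw [hout, ← hn, hnr, hcv, hLr, Nat.cast_sub hnL]
  refine ⟨?_, ?_, ?_⟩
  · rcases lt_trichotomy (dcval g i p0 b0) 0 with h | h | h
    · rw [(hneg h n le_rfl).1, Real.sign_of_neg h]; ring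
    · rw [h, abs_zero, ← hn] at hcase
      have h0 : n = 0 := by
        have : n ≤ 0 := by exact_mod_cast hcase
        omega
      rw [h0, hB0]; simp
    · rw [(hpos h n le_rfl).1, Real.sign_of_pos h]; ring
  · intro h
    rw [(hneg h n le_rfl).1]; ring
  · intro h
    rw [(hpos h n le_rfl).1]
end

section
/- For every p ∈ ℤ² and each i ∈ {1,2}, there exists a shortest path from p to g_i (of length d(p, g_i)) in which every ambiguous move precedes every explicit move: the path consists of n^a(p) = (d(p,g₁) + d(p,g₂) − d(g₁,g₂))/2 ambiguous moves followed by n^r_i(p) = (d(p,g_i) + d(g₁,g₂) − d(p,g_{3−i}))/2 explicit moves, and after the n^a(p) ambiguous moves the path reaches the region {q ∈ ℤ² : d(q,g₁) + d(q,g₂) = d(g₁,g₂)}. -/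
lemma amb_step_aux (a b p : ℤ × ℤ) (h : mdist a b < mdist p a + mdist p b) :
    ∃ p', IsUnitMove (p' - p) ∧ mdist p' a = mdist p a - 1 ∧ mdist p' b = mdist p b - 1 := by
  obtain ⟨a1, a2⟩ := a
  obtain ⟨b1, b2⟩ := b
  obtain ⟨x, y⟩ := p
  simp only [mdist, abs_eq_max_neg] at *
  have hc : (x < a1 ∧ x < b1) ∨ (a1 < x ∧ b1 < x) ∨ (y < a2 ∧ y < b2) ∨ (a2 < y ∧ b2 < y) := by
    omega
  rcases hc with hc | hc | hc | hc
  · exact ⟨(x + 1, y), by simp [IsUnitMove], by simp only []; omega, by simp only []; omega⟩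
  · exact ⟨(x - 1, y), by simp [IsUnitMove], by simp only []; omega, by simp only []; omega⟩
  · exact ⟨(x, y + 1), by simp [IsUnitMove], by simp only []; omega, by simp only []; omega⟩
  · exact ⟨(x, y - 1), by simp [IsUnitMove], by simp only []; omega, by simp only []; omega⟩

lemma exp_step_aux (a b p : ℤ × ℤ) (h : mdist p a + mdist p b = mdist a b) (h0 : 0 < mdist p a) :
    ∃ p', IsUnitMove (p' - p) ∧ mdist p' a = mdist p a - 1 ∧ mdist p' b = mdist p b + 1 := by
  obtain ⟨a1, a2⟩ := a
  obtain ⟨b1, b2⟩ := b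
  obtain ⟨x, y⟩ := p
  simp only [mdist, abs_eq_max_neg] at *
  have hc : x < a1 ∨ a1 < x ∨ y < a2 ∨ a2 < y := by
    omega
  rcases hc with hc | hc | hc | hc
  · exact ⟨(x + 1, y), by simp [IsUnitMove], by simp only []; omega, by simp only []; omega⟩
  · exact ⟨(x - 1, y), by simp [IsUnitMove], by simp only []; omega, by simp only []; omega⟩
  · exact ⟨(x, y + 1), by simp [IsUnitMove], by simp only []; omega, by simp only []; omega⟩
  · exact ⟨(x, y - 1), by simp [IsUnitMove], by simp only []; omega, by simp only []; omega⟩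

lemma count_aux (a b p : ℤ × ℤ) : ∃ A R : ℕ,
    mdist p a + mdist p b = mdist a b + 2 * A ∧ mdist p a = A + R := by
  obtain ⟨a1, a2⟩ := a
  obtain ⟨b1, b2⟩ := b
  obtain ⟨x, y⟩ := p
  simp only [mdist, abs_eq_max_neg]
  refine ⟨((max (x - a1) (-(x - a1)) + max (y - a2) (-(y - a2)) + (max (x - b1) (-(x - b1)) +
    max (y - b2) (-(y - b2))) - (max (a1 - b1) (-(a1 - b1)) + max (a2 - b2) (-(a2 - b2)))) / 2).toNat,
    ((max (x - a1) (-(x - a1)) + max (y - a2) (-(y - a2)) - (max (x - b1) (-(x - b1)) +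
    max (y - b2) (-(y - b2))) + (max (a1 - b1) (-(a1 - b1)) + max (a2 - b2) (-(a2 - b2)))) / 2).toNat,
    ?_, ?_⟩ <;> omega

lemma path_aux (a b : ℤ × ℤ) (n : ℕ) : ∀ (A R : ℕ) (p : ℤ × ℤ), A + R = n →
    mdist p a + mdist p b = mdist a b + 2 * A → mdist p a = A + R →
    ∃ q : ℕ → ℤ × ℤ, IsPath p a (A + R) q ∧
      (∀ t < A, mdist (q (t + 1)) a - mdist (q t) a = -1 ∧
        mdist (q (t + 1)) b - mdist (q t) b = -1) ∧
      (∀ t, A ≤ t → t < A + R → mdist (q (t + 1)) a - mdist (q t) a = -1 ∧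
        mdist (q (t + 1)) b - mdist (q t) b = 1) ∧
      mdist (q A) a + mdist (q A) b = mdist a b := by
  induction n with
  | zero =>
    intro A R p hn h1 h2
    obtain rfl : A = 0 := by omega
    obtain rfl : R = 0 := by omega
    refine ⟨fun _ => p, ⟨rfl, ?_, by simp⟩, by simp, by intro t _ h; omega, by simpa using h1⟩
    simp only [mdist, abs_eq_max_neg] at h2
    apply Prod.ext <;> simp only [] <;> omega
  | succ n ih =>
    intro A R p hn h1 h2
    rcases A with _ | A
    · rcases R with _ | R
      · omega
      obtain ⟨p', hu, ha, hb⟩ := exp_step_aux a b p (by simpa using h1) (by push_cast at h2; omega)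
      obtain ⟨q, ⟨q0, qT, qu⟩, -, q2, q3⟩ := ih 0 R p' (by omega) (by push_cast at *; omega)
        (by push_cast at *; omega)
      refine ⟨fun t => Nat.casesOn t p q, ⟨rfl, ?_, ?_⟩, by simp, ?_, by simpa using h1⟩
      · simpa [← add_assoc] using qT
      · rintro (_ | t) ht
        · simpa [q0] using hu
        · exact qu t (by omega)
      · rintro (_ | t) _ ht
        · change mdist (q 0) a - mdist p a = -1 ∧ mdist (q 0) b - mdist p b = 1
          rw [q0]; omega
        · exact q2 t (by omega) (by omega)
    · obtain ⟨p', hu, ha, hb⟩ := amb_step_aux a b p (by push_cast at h1; omega)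
      obtain ⟨q, ⟨q0, qT, qu⟩, q1, q2, q3⟩ := ih A R p' (by omega) (by push_cast at *; omega)
        (by push_cast at *; omega)
      have e : A + 1 + R = (A + R) + 1 := by omega
      refine ⟨fun t => Nat.casesOn t p q, ⟨rfl, ?_, ?_⟩, ?_, ?_, q3⟩
      · rw [e]; exact qT
      · rintro (_ | t) ht
        · simpa [q0] using hu
        · exact qu t (by omega)
      · rintro (_ | t) ht
        · change mdist (q 0) a - mdist p a = -1 ∧ mdist (q 0) b - mdist p b = -1
          rw [q0]; omega
        · exact q1 t (by omega)
      · rintro (_ | t) _ ht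
        · omega
        · exact q2 t (by omega) (by omega)

lemma mdist_comm_aux (a b : ℤ × ℤ) : mdist a b = mdist b a := by
  simp only [mdist, abs_sub_comm]

/-- from every `p` there is a shortest path to `g_i` consisting of
`n^a(p) = (d(p,g₁)+d(p,g₂)−d(g₁,g₂))/2` ambiguous moves followed by
`n^r_i(p) = (d(p,g_i)+d(g₁,g₂)−d(p,g_{3−i}))/2` explicit moves, reaching the region
`{q : d(q,g₁)+d(q,g₂) = d(g₁,g₂)}` after the ambiguous moves. -/
theorem exists_shortest_path_ambiguous_first
    (g : Fin 2 → ℤ × ℤ) (hg : g 0 ≠ g 1) (p : ℤ × ℤ) (i : Fin 2) :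
    ∃ (A T : ℕ) (q : ℕ → ℤ × ℤ),
      (A : ℤ) = (mdist p (g 0) + mdist p (g 1) - mdist (g 0) (g 1)) / 2 ∧
      (T : ℤ) = mdist p (g i) ∧
      (T : ℤ) - (A : ℤ) =
        (mdist p (g i) + mdist (g 0) (g 1) - mdist p (g (1 - i))) / 2 ∧
      IsPath p (g i) T q ∧
      (∀ t < T, (IsAmbStep g (q t) (q (t + 1)) ↔ t < A)) ∧
      (∀ t, A ≤ t → t < T → IsExpStep g (q t) (q (t + 1))) ∧
      mdist (q A) (g 0) + mdist (q A) (g 1) = mdist (g 0) (g 1) := by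
  obtain ⟨A, R, h1, h2⟩ := count_aux (g i) (g (1 - i)) p
  obtain ⟨q, hp, q1, q2, q3⟩ := path_aux (g i) (g (1 - i)) _ A R p rfl h1 h2
  have hc := mdist_comm_aux (g 0) (g 1)
  refine ⟨A, A + R, q, ?_, ?_, ?_, hp, ?_, ?_, ?_⟩
  · fin_cases i <;> simp at * <;> omega
  · push_cast; omega
  · fin_cases i <;> simp at * <;> omega
  · intro t ht
    constructor
    · intro h
      by_contra hlt
      have := q2 t (by omega) ht
      unfold IsAmbStep at h
      fin_cases i <;> simp at * <;> omega
    · intro h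
      have := q1 t h
      unfold IsAmbStep
      fin_cases i <;> simp at * <;> omega
  · intro t h ht
    have := q2 t h ht
    unfold IsExpStep
    fin_cases i <;> simp at * <;> omega
  · fin_cases i <;> simp at * <;> omega
end
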